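/- arXiv:2303.05769 — 17 statements merged into one kernel-verified Lean document; each statement's English description precedes it below -/
import Mathlib

section
/- Let A₀ ≥ −1 and set R = 1 + √(1+A₀). If X₀, Y₀, Z₀ ∈ ℝ satisfy X₀ ≤ min(−|Z₀|, −R), then X₁ ≤ X₀, where X₁ = A₀ − (X₀² + Y₀²) − Z₀; equality X₁ = X₀ holds if and only if (X₀, Y₀, Z₀) = (−R, 0, −R). -/
theorem stmt_3 (A₀ : ℝ) (hA₀ : -1 ≤ A₀) (R : ℝ) (hR : R = 1 + Real.sqrt (1 + A₀))
    (X₀ Y₀ Z₀ : ℝ) (h : X₀ ≤ min (-|Z₀|) (-R)) :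
    A₀ - (X₀ ^ 2 + Y₀ ^ 2) - Z₀ ≤ X₀ ∧
    (A₀ - (X₀ ^ 2 + Y₀ ^ 2) - Z₀ = X₀ ↔ X₀ = -R ∧ Y₀ = 0 ∧ Z₀ = -R) := by
  obtain ⟨hXZ, hXR⟩ := le_min_iff.mp h
  have hZ : X₀ ≤ Z₀ := by linarith [neg_abs_le Z₀]
  have hR1 : 1 ≤ R := by linarith [Real.sqrt_nonneg (1 + A₀)]
  have hA : A₀ = R ^ 2 - 2 * R := by
    have hs := Real.sq_sqrt (show 0 ≤ 1 + A₀ by linarith)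
    rw [show Real.sqrt (1 + A₀) = R - 1 by linarith] at hs
    linarith
  have hprod : 0 ≤ (-X₀ - R) * (-X₀ + R - 2) :=
    mul_nonneg (by linarith) (by linarith)
  have hY := sq_nonneg Y₀
  have key : X₀ - (A₀ - (X₀ ^ 2 + Y₀ ^ 2) - Z₀) =
      (-X₀ - R) * (-X₀ + R - 2) + Y₀ ^ 2 + (Z₀ - X₀) := by
    rw [hA]; ring
  refine ⟨by linarith, fun heq => ?_, ?_⟩
  · have hX : X₀ = -R := by
      by_contra hne
      have hlt : X₀ < -R := lt_of_le_of_ne hXR hne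
      have : 0 < (-X₀ - R) * (-X₀ + R - 2) := mul_pos (by linarith) (by linarith)
      linarith
    exact ⟨hX, pow_eq_zero_iff two_ne_zero |>.mp (by linarith), by linarith⟩
  · rintro ⟨rfl, rfl, rfl⟩
    rw [hA]; ring
end

section
/- Let A₀ ≥ −1 and set R = 1 + √(1+A₀). If X₀, Z₀, W₀ ∈ ℝ satisfy −|Z₀| ≤ X₀ and Z₀ ≤ −R, then Z₋₁ ≤ Z₀ and |Z₀| ≤ |Z₋₁|, where Z₋₁ = A₀ − (Z₀² + W₀²) − X₀; equality holds in both if and only if (X₀, Z₀, W₀) = (−R, −R, 0). -/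
theorem stmt_4 (A₀ : ℝ) (hA₀ : -1 ≤ A₀) (R : ℝ) (hR : R = 1 + Real.sqrt (1 + A₀))
    (X₀ Z₀ W₀ : ℝ) (h₁ : -|Z₀| ≤ X₀) (h₂ : Z₀ ≤ -R) :
    A₀ - (Z₀ ^ 2 + W₀ ^ 2) - X₀ ≤ Z₀ ∧
    |Z₀| ≤ |A₀ - (Z₀ ^ 2 + W₀ ^ 2) - X₀| ∧
    ((A₀ - (Z₀ ^ 2 + W₀ ^ 2) - X₀ = Z₀ ∧ |Z₀| = |A₀ - (Z₀ ^ 2 + W₀ ^ 2) - X₀|) ↔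
      X₀ = -R ∧ Z₀ = -R ∧ W₀ = 0) := by
  have hs := Real.sqrt_nonneg (1 + A₀)
  have hsq : Real.sqrt (1 + A₀) ^ 2 = 1 + A₀ := Real.sq_sqrt (by linarith)
  have hR1 : 1 ≤ R := by linarith
  have hRA : R ^ 2 - 2 * R = A₀ := by rw [hR]; linear_combination hsq
  have hZ : |Z₀| = -Z₀ := abs_of_nonpos (by linarith)
  rw [hZ, neg_neg] at h₁
  have hprod : (-Z₀ - R) ^ 2 ≤ (-Z₀ - R) * (-Z₀ + R - 2) := by
    nlinarith [mul_nonneg (show 0 ≤ -Z₀ - R by linarith) (show 0 ≤ R - 1 by linarith)]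
  have hle : A₀ - (Z₀ ^ 2 + W₀ ^ 2) - X₀ ≤ Z₀ := by
    nlinarith [sq_nonneg (-Z₀ - R), sq_nonneg W₀]
  refine ⟨hle, abs_le_abs_of_nonpos (by linarith) hle, ?_⟩
  constructor
  · rintro ⟨heq, -⟩
    have hZR : -Z₀ - R = 0 := by
      apply pow_eq_zero_iff two_ne_zero |>.mp
      nlinarith [sq_nonneg (-Z₀ - R), sq_nonneg W₀]
    have hW : W₀ = 0 := by
      apply pow_eq_zero_iff two_ne_zero |>.mp
      nlinarith [sq_nonneg (-Z₀ - R), sq_nonneg W₀]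
    have hX : X₀ = Z₀ := by
      nlinarith [sq_nonneg (-Z₀ - R), sq_nonneg W₀]
    exact ⟨by linarith, by linarith, hW⟩
  · rintro ⟨hX, hZR, hW⟩
    have heq : A₀ - (Z₀ ^ 2 + W₀ ^ 2) - X₀ = Z₀ := by
      rw [hX, hZR, hW]; linear_combination -hRA
    exact ⟨heq, by rw [heq]⟩
end

section
/- Let F be the transformed coupled Hénon map with parameters A₀ ≥ −1, A₁ ∈ ℝ, c > 0, and R = 1 + √(1+A₀). For every point p = (X,Y,Z,W) in the region N₁ = {(X,Y,Z,W) ∈ ℝ⁴ : X ≤ min(−|Z|, −R)}, the first coordinate of F(p) is at most X, and it is strictly less than X unless (X,Y,Z) = (−R, 0, −R). -/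
/-- The transformed coupled Hénon map on ℝ⁴. -/
noncomputable def transformedHenon (A₀ A₁ c : ℝ) : ℝ × ℝ × ℝ × ℝ → ℝ × ℝ × ℝ × ℝ :=
  fun p => (A₀ - (p.1 ^ 2 + p.2.1 ^ 2) - p.2.2.1,
            A₁ - 2 * p.1 * p.2.1 - p.2.2.2 + 2 * c * p.2.1,
            p.1, p.2.1)

/-- The region N₁ = {(X,Y,Z,W) : X ≤ min(−|Z|, −R)}. -/
def regionN₁ (R : ℝ) : Set (ℝ × ℝ × ℝ × ℝ) :=
  {p | p.1 ≤ min (-|p.2.2.1|) (-R)}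

theorem stmt_5 (A₀ A₁ c : ℝ) (hA₀ : -1 ≤ A₀) (hc : 0 < c)
    (R : ℝ) (hR : R = 1 + Real.sqrt (1 + A₀))
    (p : ℝ × ℝ × ℝ × ℝ) (hp : p ∈ regionN₁ R) :
    (transformedHenon A₀ A₁ c p).1 ≤ p.1 ∧
    (¬(p.1 = -R ∧ p.2.1 = 0 ∧ p.2.2.1 = -R) → (transformedHenon A₀ A₁ c p).1 < p.1) := by
  obtain ⟨X, Y, Z, W⟩ := p
  have hs := Real.sq_sqrt (show (0 : ℝ) ≤ 1 + A₀ by linarith)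
  have hs₀ := Real.sqrt_nonneg (1 + A₀)
  have hA : A₀ = R ^ 2 - 2 * R := by rw [hR]; linarith
  have hR₁ : 1 ≤ R := by linarith
  simp only [regionN₁, Set.mem_ofPred_eq, le_min_iff] at hp
  obtain ⟨hXZ, hXR⟩ := hp
  have hZ : X ≤ Z := by linarith [neg_abs_le Z]
  simp only [transformedHenon]
  have hprod : 0 ≤ (-R - X) * (R - X - 2) :=
    mul_nonneg (by linarith) (by linarith)
  have hY := sq_nonneg Y
  refine ⟨by rw [hA]; linarith, fun hne => ?_⟩
  by_contra! hle
  rw [hA] at hle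
  have hY₀ : Y = 0 := pow_eq_zero_iff two_ne_zero |>.mp (by linarith)
  have hprod₀ : (-R - X) * (R - X - 2) = 0 := by linarith
  have hX : X = -R := by
    rcases mul_eq_zero.mp hprod₀ with h | h <;> linarith
  exact hne ⟨hX, hY₀, by linarith⟩
end

section
/- Let F be the transformed coupled Hénon map with parameters A₀ ≥ −1, A₁ ∈ ℝ, c > 0, and R = 1 + √(1+A₀). Then the region N₁ = {(X,Y,Z,W) ∈ ℝ⁴ : X ≤ min(−|Z|, −R)} is forward invariant: F(N₁) ⊆ N₁. -/
theorem stmt_6 (A₀ A₁ c : ℝ) (hA₀ : -1 ≤ A₀) (hc : 0 < c)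
    (R : ℝ) (hR : R = 1 + Real.sqrt (1 + A₀)) :
    transformedHenon A₀ A₁ c '' regionN₁ R ⊆ regionN₁ R := by
  rintro _ ⟨⟨X, Y, Z, W⟩, hp, rfl⟩
  simp only [regionN₁, transformedHenon, Set.mem_ofPred_eq, le_min_iff] at hp ⊢
  obtain ⟨hXZ, hXR⟩ := hp
  have hs : 0 ≤ √(1 + A₀) := Real.sqrt_nonneg _
  have hsq : √(1 + A₀) ^ 2 = 1 + A₀ := Real.sq_sqrt (by linarith)
  have hX : X ≤ 0 := by linarith
  have hZ : -|Z| ≤ Z := neg_abs_le Z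
  have hgap : √(1 + A₀) ^ 2 ≤ (-X - 1) ^ 2 := pow_le_pow_left₀ hs (by linarith) 2
  have hle : A₀ - (X ^ 2 + Y ^ 2) - Z ≤ X := by nlinarith [sq_nonneg Y]
  rw [abs_of_nonpos hX, neg_neg]
  exact ⟨hle, hle.trans hXR⟩
end

section
/- Let F be the transformed coupled Hénon map with parameters A₀ ≥ −1, A₁ ∈ ℝ, c > 0, and R = 1 + √(1+A₀). Then F(N₂) ⊆ N₁ ∪ N₂ and F(N₃) ⊆ N₁ ∪ N₂, where N₁ = {(X,Y,Z,W) ∈ ℝ⁴ : X ≤ min(−|Z|, −R)}, N₂ = {(X,Y,Z,W) ∈ ℝ⁴ : X ≥ −R and |Z| ≤ R}, and N₃ = {(X,Y,Z,W) ∈ ℝ⁴ : X ≥ −|Z| and Z ≥ R}. -/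
/-- The region N₂ = {(X,Y,Z,W) : X ≥ −R and |Z| ≤ R}. -/
def regionN₂ (R : ℝ) : Set (ℝ × ℝ × ℝ × ℝ) :=
  {p | p.1 ≥ -R ∧ |p.2.2.1| ≤ R}

/-- The region N₃ = {(X,Y,Z,W) : X ≥ −|Z| and Z ≥ R}. -/
def regionN₃ (R : ℝ) : Set (ℝ × ℝ × ℝ × ℝ) :=
  {p | p.1 ≥ -|p.2.2.1| ∧ p.2.2.1 ≥ R}

/-- A point with `Z ≥ -R` and either `X ≥ -R` or `X ≥ -Z` is mapped into `N₁ ∪ N₂`. -/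
theorem transformedHenon_mem_union {A₀ R : ℝ} (A₁ c : ℝ) (hR : 1 ≤ R)
    (hRsq : R ^ 2 = 2 * R + A₀) {p : ℝ × ℝ × ℝ × ℝ} (hZ : -R ≤ p.2.2.1)
    (hX : -R ≤ p.1 ∨ -p.2.2.1 ≤ p.1) :
    transformedHenon A₀ A₁ c p ∈ regionN₁ R ∪ regionN₂ R := by
  obtain ⟨X, Y, Z, W⟩ := p
  simp only [transformedHenon, regionN₁, regionN₂, Set.mem_union, Set.mem_ofPred_eq,
    le_min_iff] at *
  by_cases hXR : |X| ≤ R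
  · rcases le_total (-R) (A₀ - (X ^ 2 + Y ^ 2) - Z) with h | h
    · exact Or.inr ⟨h, hXR⟩
    · exact Or.inl ⟨by linarith, h⟩
  · rw [not_le] at hXR
    have key : A₀ - (X ^ 2 + Y ^ 2) - Z ≤ -|X| := by
      rcases le_total 0 X with h0 | h0
      · rw [abs_of_nonneg h0] at hXR ⊢
        have h1 : 0 ≤ (X - R) * (X + R - 1) := mul_nonneg (by linarith) (by linarith)
        nlinarith [sq_nonneg Y]
      · rw [abs_of_nonpos h0] at hXR ⊢
        have hXZ : -Z ≤ X := hX.resolve_left (by linarith)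
        nlinarith [sq_nonneg Y]
    exact Or.inl ⟨key, by linarith⟩

theorem stmt_7 (A₀ A₁ c : ℝ) (hA₀ : -1 ≤ A₀) (hc : 0 < c)
    (R : ℝ) (hR : R = 1 + Real.sqrt (1 + A₀)) :
    transformedHenon A₀ A₁ c '' regionN₂ R ⊆ regionN₁ R ∪ regionN₂ R ∧
    transformedHenon A₀ A₁ c '' regionN₃ R ⊆ regionN₁ R ∪ regionN₂ R := by
  have hR1 : 1 ≤ R := by
    rw [hR]
    linarith [Real.sqrt_nonneg (1 + A₀)]
  have hRsq : R ^ 2 = 2 * R + A₀ := by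
    rw [hR]
    linarith [Real.sq_sqrt (by linarith : 0 ≤ 1 + A₀)]
  constructor
  · rintro _ ⟨p, ⟨hX, hZ⟩, rfl⟩
    exact transformedHenon_mem_union A₁ c hR1 hRsq (abs_le.mp hZ).1 (Or.inl hX)
  · rintro _ ⟨p, ⟨hX, hZ⟩, rfl⟩
    rw [abs_of_nonneg (by linarith)] at hX
    exact transformedHenon_mem_union A₁ c hR1 hRsq (by linarith) (Or.inr hX)
end

section
/- Let F⁻¹(X,Y,Z,W) = (Z, W, A₀ − (Z²+W²) − X, A₁ − 2ZW − Y + 2cW) be the inverse of the transformed coupled Hénon map, with parameters A₀ ≥ −1, A₁ ∈ ℝ, c > 0, and R = 1 + √(1+A₀). For every point p = (X,Y,Z,W) in the region N₄ = {(X,Y,Z,W) ∈ ℝ⁴ : X ≥ −|Z| and Z ≤ −R}, the third coordinate of F⁻¹(p) is at most Z, and it is strictly less than Z unless (X,Z,W) = (−R, −R, 0). -/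
/-- The inverse of the transformed coupled Hénon map on ℝ⁴. -/
noncomputable def transformedHenonInv (A₀ A₁ c : ℝ) : ℝ × ℝ × ℝ × ℝ → ℝ × ℝ × ℝ × ℝ :=
  fun p => (p.2.2.1, p.2.2.2,
            A₀ - (p.2.2.1 ^ 2 + p.2.2.2 ^ 2) - p.1,
            A₁ - 2 * p.2.2.1 * p.2.2.2 - p.2.1 + 2 * c * p.2.2.2)

/-- The region N₄ = {(X,Y,Z,W) : X ≥ −|Z| and Z ≤ −R}. -/
def regionN₄ (R : ℝ) : Set (ℝ × ℝ × ℝ × ℝ) :=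
  {p | p.1 ≥ -|p.2.2.1| ∧ p.2.2.1 ≤ -R}

theorem stmt_8 (A₀ A₁ c : ℝ) (hA₀ : -1 ≤ A₀) (hc : 0 < c)
    (R : ℝ) (hR : R = 1 + Real.sqrt (1 + A₀))
    (p : ℝ × ℝ × ℝ × ℝ) (hp : p ∈ regionN₄ R) :
    (transformedHenonInv A₀ A₁ c p).2.2.1 ≤ p.2.2.1 ∧
    (¬(p.1 = -R ∧ p.2.2.1 = -R ∧ p.2.2.2 = 0) →
      (transformedHenonInv A₀ A₁ c p).2.2.1 < p.2.2.1) := by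
  obtain ⟨X, Y, Z, W⟩ := p
  obtain ⟨hX, hZ⟩ := hp
  simp only [transformedHenonInv] at hX hZ ⊢
  have hs : 0 ≤ √(1 + A₀) := Real.sqrt_nonneg _
  have hs2 : √(1 + A₀) ^ 2 = 1 + A₀ := Real.sq_sqrt (by linarith)
  generalize √(1 + A₀) = s at *
  rw [abs_of_nonpos (by linarith), neg_neg] at hX
  have hZs : 0 ≤ -(Z + R) * s := mul_nonneg (by linarith) hs
  have key : Z - (A₀ - (Z ^ 2 + W ^ 2) - X) =
      (X - Z) + W ^ 2 + (Z + R) ^ 2 + 2 * (-(Z + R) * s) := by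
    subst hR
    linear_combination hs2
  have hW2 := sq_nonneg W
  have hZ2 := sq_nonneg (Z + R)
  refine ⟨by linarith, fun hne => ?_⟩
  by_contra! hle
  have hZR : Z + R = 0 := pow_eq_zero_iff two_ne_zero |>.mp (by linarith)
  have hW : W = 0 := pow_eq_zero_iff two_ne_zero |>.mp (by linarith)
  exact hne ⟨by linarith, by linarith, hW⟩
end

section
/- Let F⁻¹(X,Y,Z,W) = (Z, W, A₀ − (Z²+W²) − X, A₁ − 2ZW − Y + 2cW) be the inverse of the transformed coupled Hénon map, with parameters A₀ ≥ −1, A₁ ∈ ℝ, c > 0, and R = 1 + √(1+A₀). Then F⁻¹(N₃) ⊆ N₄ and F⁻¹(N₄) ⊆ N₄, where N₃ = {(X,Y,Z,W) ∈ ℝ⁴ : X ≥ −|Z| and Z ≥ R} and N₄ = {(X,Y,Z,W) ∈ ℝ⁴ : X ≥ −|Z| and Z ≤ −R}. -/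
/-- If `R = 1 + √(1 + A₀)` and `R ≤ |Z|`, then the third coordinate of the inverse map is at
most `-|Z|` at any point with `X ≥ -|Z|`. -/
theorem transformedHenonInv_third_le_neg_abs {A₀ X Z W : ℝ} (hA₀ : -1 ≤ A₀)
    (hX : -|Z| ≤ X) (hZ : 1 + Real.sqrt (1 + A₀) ≤ |Z|) :
    A₀ - (Z ^ 2 + W ^ 2) - X ≤ -|Z| := by
  have hsq : Real.sqrt (1 + A₀) ^ 2 = 1 + A₀ := Real.sq_sqrt (by linarith)
  have hle : Real.sqrt (1 + A₀) ^ 2 ≤ (|Z| - 1) ^ 2 :=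
    pow_le_pow_left₀ (Real.sqrt_nonneg _) (by linarith) 2
  nlinarith [sq_abs Z, sq_nonneg W]

theorem transformedHenonInv_mem_regionN₄ {A₀ A₁ c : ℝ} {p : ℝ × ℝ × ℝ × ℝ} (hA₀ : -1 ≤ A₀)
    (hX : -|p.2.2.1| ≤ p.1) (hZ : 1 + Real.sqrt (1 + A₀) ≤ |p.2.2.1|) :
    transformedHenonInv A₀ A₁ c p ∈ regionN₄ (1 + Real.sqrt (1 + A₀)) := by
  have h := transformedHenonInv_third_le_neg_abs (W := p.2.2.2) hA₀ hX hZ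
  simp only [transformedHenonInv, regionN₄, Set.mem_ofPred_eq]
  refine ⟨?_, by linarith⟩
  have h₁ := neg_le_abs (A₀ - (p.2.2.1 ^ 2 + p.2.2.2 ^ 2) - p.1)
  have h₂ := neg_abs_le p.2.2.1
  linarith

theorem stmt_9 (A₀ A₁ c : ℝ) (hA₀ : -1 ≤ A₀) (hc : 0 < c)
    (R : ℝ) (hR : R = 1 + Real.sqrt (1 + A₀)) :
    transformedHenonInv A₀ A₁ c '' regionN₃ R ⊆ regionN₄ R ∧
    transformedHenonInv A₀ A₁ c '' regionN₄ R ⊆ regionN₄ R := by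
  subst hR
  constructor
  · rintro _ ⟨p, ⟨hX, hZ⟩, rfl⟩
    exact transformedHenonInv_mem_regionN₄ hA₀ hX (hZ.trans (le_abs_self _))
  · rintro _ ⟨p, ⟨hX, hZ⟩, rfl⟩
    exact transformedHenonInv_mem_regionN₄ hA₀ hX ((le_neg_of_le_neg hZ).trans (neg_le_abs _))
end

section
/- Let F⁻¹(X,Y,Z,W) = (Z, W, A₀ − (Z²+W²) − X, A₁ − 2ZW − Y + 2cW) be the inverse of the transformed coupled Hénon map, with parameters A₀ ≥ −1, A₁ ∈ ℝ, c > 0, and R = 1 + √(1+A₀). Then F⁻¹(N₂) ⊆ N₂ ∪ N₃ ∪ N₄, where N₂ = {(X,Y,Z,W) ∈ ℝ⁴ : X ≥ −R and |Z| ≤ R}, N₃ = {(X,Y,Z,W) ∈ ℝ⁴ : X ≥ −|Z| and Z ≥ R}, and N₄ = {(X,Y,Z,W) ∈ ℝ⁴ : X ≥ −|Z| and Z ≤ −R}. -/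
theorem stmt_10 (A₀ A₁ c : ℝ) (hA₀ : -1 ≤ A₀) (hc : 0 < c)
    (R : ℝ) (hR : R = 1 + Real.sqrt (1 + A₀)) :
    transformedHenonInv A₀ A₁ c '' regionN₂ R ⊆ regionN₂ R ∪ regionN₃ R ∪ regionN₄ R := by
  rintro _ ⟨p, ⟨-, hZ⟩, rfl⟩
  have hX : -R ≤ p.2.2.1 := (abs_le.mp hZ).1
  set q := transformedHenonInv A₀ A₁ c p
  have hqX : -R ≤ q.1 := hX
  rcases le_total |q.2.2.1| R with h | h
  · exact Or.inl (Or.inl ⟨hqX, h⟩)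
  · have hqX' : -|q.2.2.1| ≤ q.1 := (neg_le_neg h).trans hqX
    rcases le_abs.mp h with h | h
    · exact Or.inl (Or.inr ⟨hqX', h⟩)
    · exact Or.inr ⟨hqX', le_neg.mp h⟩
end

section
/- Let F be the transformed coupled Hénon map with parameters A₀ ≥ −1, A₁ ∈ ℝ, c > 0, and R = 1 + √(1+A₀). Then every non-wandering point of F lies in the region N₂ = {(X,Y,Z,W) ∈ ℝ⁴ : X ≥ −R and |Z| ≤ R}; that is, the non-wandering set Ω(F) satisfies Ω(F) ⊆ N₂. -/
/-- A point `p` is non-wandering for `g` if every open neighborhood `U` of `p`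
returns to meet itself under some iterate `g^[n]`, `n ≥ 1`. -/
def IsNonWandering (g : ℝ × ℝ × ℝ × ℝ → ℝ × ℝ × ℝ × ℝ) (p : ℝ × ℝ × ℝ × ℝ) : Prop :=
  ∀ U : Set (ℝ × ℝ × ℝ × ℝ), IsOpen U → p ∈ U →
    ∃ n : ℕ, 1 ≤ n ∧ (g^[n] '' U ∩ U).Nonempty

theorem not_isNonWandering_of_forward_trap {g : ℝ × ℝ × ℝ × ℝ → ℝ × ℝ × ℝ × ℝ}
    {p : ℝ × ℝ × ℝ × ℝ} {U V : Set (ℝ × ℝ × ℝ × ℝ)} (hU : IsOpen U) (hpU : p ∈ U)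
    (hUV : Set.MapsTo g U V) (hV : Set.MapsTo g V V) (hd : Disjoint U V) :
    ¬ IsNonWandering g p := by
  intro hp
  obtain ⟨n, hn, _, ⟨q, hq, rfl⟩, hqU⟩ := hp U hU hpU
  obtain ⟨k, rfl⟩ := Nat.exists_eq_add_of_le' hn
  rw [Function.iterate_succ_apply] at hqU
  exact Set.disjoint_left.1 hd hqU (hV.iterate k (hUV hq))

theorem not_isNonWandering_of_backward_trap {g : ℝ × ℝ × ℝ × ℝ → ℝ × ℝ × ℝ × ℝ}
    {p : ℝ × ℝ × ℝ × ℝ} {U V : Set (ℝ × ℝ × ℝ × ℝ)} (hU : IsOpen U) (hpU : p ∈ U)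
    (hUV : g ⁻¹' U ⊆ V) (hV : g ⁻¹' V ⊆ V) (hd : Disjoint U V) :
    ¬ IsNonWandering g p := by
  intro hp
  obtain ⟨n, hn, _, ⟨q, hq, rfl⟩, hqU⟩ := hp U hU hpU
  obtain ⟨k, rfl⟩ := Nat.exists_eq_add_of_le' hn
  rw [Function.iterate_succ_apply'] at hqU
  have pull : ∀ j : ℕ, g^[j] q ∈ V → q ∈ V := by
    intro j
    induction j with
    | zero => exact id
    | succ j ih =>
      intro h
      rw [Function.iterate_succ_apply'] at h
      exact ih (hV h)
  exact Set.disjoint_left.1 hd hq (pull k (hUV hqU))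

theorem sub_sq_sub_self_lt_of_lt_neg {A₀ x : ℝ} (hA₀ : -1 ≤ A₀)
    (hx : x < -(1 + Real.sqrt (1 + A₀))) : A₀ - x ^ 2 - x < x := by
  have hs := Real.sq_sqrt (show 0 ≤ 1 + A₀ by linarith)
  nlinarith [Real.sqrt_nonneg (1 + A₀)]

theorem not_isNonWandering_of_image_fst_lt {A₀ A₁ c m : ℝ} (hA₀ : -1 ≤ A₀)
    (hm : m ≤ -(1 + Real.sqrt (1 + A₀))) {p : ℝ × ℝ × ℝ × ℝ}
    (hp : m < p.1) (hFp : A₀ - (p.1 ^ 2 + p.2.1 ^ 2) - p.2.2.1 < m) :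
    ¬ IsNonWandering (transformedHenon A₀ A₁ c) p := by
  refine not_isNonWandering_of_forward_trap
    (U := {q | m < q.1 ∧ A₀ - (q.1 ^ 2 + q.2.1 ^ 2) - q.2.2.1 < m})
    (V := {q | q.1 < m ∧ q.1 ≤ q.2.2.1}) ?_ ⟨hp, hFp⟩ ?_ ?_ ?_
  · rw [Set.ofPred_and]
    apply IsOpen.inter <;> apply isOpen_lt <;> fun_prop
  · rintro q ⟨h₁, h₂⟩
    exact ⟨h₂, (h₂.trans h₁).le⟩
  · rintro q ⟨h₁, h₂⟩
    have h := sub_sq_sub_self_lt_of_lt_neg hA₀ (h₁.trans_le hm)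
    have hlt : A₀ - (q.1 ^ 2 + q.2.1 ^ 2) - q.2.2.1 < q.1 := by
      linarith [sq_nonneg q.2.1]
    exact ⟨hlt.trans h₁, hlt.le⟩
  · exact Set.disjoint_left.2 fun q hU hV => lt_asymm hU.1 hV.1

theorem not_isNonWandering_of_preimage_thd_lt {A₀ A₁ c m : ℝ} (hA₀ : -1 ≤ A₀)
    (hm : m ≤ -(1 + Real.sqrt (1 + A₀))) {p : ℝ × ℝ × ℝ × ℝ}
    (hp : m < p.2.2.1) (hFp : A₀ - (p.2.2.1 ^ 2 + p.2.2.2 ^ 2) - p.1 < m) :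
    ¬ IsNonWandering (transformedHenon A₀ A₁ c) p := by
  refine not_isNonWandering_of_backward_trap
    (U := {q | m < q.2.2.1 ∧ A₀ - (q.2.2.1 ^ 2 + q.2.2.2 ^ 2) - q.1 < m})
    (V := {q | q.2.2.1 < m ∧ q.2.2.1 ≤ q.1}) ?_ ⟨hp, hFp⟩ ?_ ?_ ?_
  · rw [Set.ofPred_and]
    apply IsOpen.inter <;> apply isOpen_lt <;> fun_prop
  · rintro q ⟨h₁, h₂⟩
    simp only [transformedHenon] at h₁ h₂
    exact ⟨by linarith, by linarith⟩
  · rintro q ⟨h₁, h₂⟩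
    simp only [transformedHenon] at h₁ h₂
    have h := sub_sq_sub_self_lt_of_lt_neg hA₀ (h₁.trans_le hm)
    have hlt : q.2.2.1 < q.1 := by linarith [sq_nonneg q.2.1]
    exact ⟨hlt.trans h₁, hlt.le⟩
  · exact Set.disjoint_left.2 fun q hU hV => lt_asymm hU.1 hV.1

theorem stmt_11 (A₀ A₁ c : ℝ) (hA₀ : -1 ≤ A₀) (hc : 0 < c)
    (R : ℝ) (hR : R = 1 + Real.sqrt (1 + A₀))
    (p : ℝ × ℝ × ℝ × ℝ) (hp : IsNonWandering (transformedHenon A₀ A₁ c) p) :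
    p ∈ regionN₂ R := by
  subst hR
  have hmin : -(1 + Real.sqrt (1 + A₀)) ≤ min p.1 p.2.2.1 := by
    by_contra! hlt
    rcases le_total p.1 p.2.2.1 with hle | hle
    · rw [min_eq_left hle] at hlt
      have h := sub_sq_sub_self_lt_of_lt_neg hA₀ hlt
      obtain ⟨m, hm₁, hm₂⟩ := exists_between
        (show A₀ - (p.1 ^ 2 + p.2.1 ^ 2) - p.2.2.1 < p.1 by linarith [sq_nonneg p.2.1])
      exact not_isNonWandering_of_image_fst_lt hA₀ (hm₂.trans hlt).le hm₂ hm₁ hp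
    · rw [min_eq_right hle] at hlt
      have h := sub_sq_sub_self_lt_of_lt_neg hA₀ hlt
      obtain ⟨m, hm₁, hm₂⟩ := exists_between
        (show A₀ - (p.2.2.1 ^ 2 + p.2.2.2 ^ 2) - p.1 < p.2.2.1 by
          linarith [sq_nonneg p.2.2.2])
      exact not_isNonWandering_of_preimage_thd_lt hA₀ (hm₂.trans hlt).le hm₂ hm₁ hp
  obtain ⟨hX, hZ⟩ := le_min_iff.1 hmin
  refine ⟨hX, abs_le.2 ⟨hZ, ?_⟩⟩
  by_contra! hlt
  have hs := Real.sq_sqrt (show 0 ≤ 1 + A₀ by linarith)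
  have hs₀ := Real.sqrt_nonneg (1 + A₀)
  refine not_isNonWandering_of_preimage_thd_lt hA₀ le_rfl (by linarith) ?_ hp
  nlinarith [sq_nonneg p.2.2.2]
end

section
/- Let f : ℝ⁴ → ℝ⁴ be the coupled Hénon map with real parameters a₀, a₁ and c > 0, set A₀ = (a₀+a₁)/2, and assume A₀ ≥ −1. Then every non-wandering point (x,y,z,w) of f satisfies |x| ≤ r, |y| ≤ r, |z| ≤ r, and |w| ≤ r, where r = 2√2·(1 + √(1+A₀)); that is, Ω(f) ⊆ V_f = {(x,y,z,w) : |x|,|y|,|z|,|w| ≤ r}. -/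
/-- The coupled Hénon map on ℝ⁴. -/
noncomputable def coupledHenon (a₀ a₁ c : ℝ) : ℝ × ℝ × ℝ × ℝ → ℝ × ℝ × ℝ × ℝ :=
  fun p => (a₀ - p.1 ^ 2 - p.2.2.1 + c * (p.1 - p.2.1),
            a₁ - p.2.1 ^ 2 - p.2.2.2 - c * (p.1 - p.2.1),
            p.1, p.2.1)

/-- The Euclidean norm of the current pair `(x, y)`. -/
noncomputable def headNorm (p : ℝ × ℝ × ℝ × ℝ) : ℝ := √(p.1 ^ 2 + p.2.1 ^ 2)

/-- The Euclidean norm of the previous pair `(z, w)`. -/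
noncomputable def tailNorm (p : ℝ × ℝ × ℝ × ℝ) : ℝ := √(p.2.2.1 ^ 2 + p.2.2.2 ^ 2)

/-- The involution exchanging the current and the previous pair. -/
def swapPairs (p : ℝ × ℝ × ℝ × ℝ) : ℝ × ℝ × ℝ × ℝ := (p.2.2.1, p.2.2.2, p.1, p.2.1)

theorem continuous_coupledHenon (a₀ a₁ c : ℝ) : Continuous (coupledHenon a₀ a₁ c) := by
  unfold coupledHenon
  fun_prop

theorem continuous_headNorm : Continuous headNorm := by
  unfold headNorm
  fun_prop

theorem continuous_swapPairs : Continuous swapPairs := by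
  unfold swapPairs
  fun_prop

/-- The coupled Hénon map is reversible: conjugation by `swapPairs` inverts it. -/
theorem coupledHenon_swapPairs_coupledHenon (a₀ a₁ c : ℝ) (p : ℝ × ℝ × ℝ × ℝ) :
    coupledHenon a₀ a₁ c (swapPairs (coupledHenon a₀ a₁ c p)) = swapPairs p := by
  simp only [coupledHenon, swapPairs, Prod.mk.injEq, and_true]
  constructor <;> ring

theorem iterate_coupledHenon_swapPairs (a₀ a₁ c : ℝ) (n : ℕ) (p : ℝ × ℝ × ℝ × ℝ) :
    (coupledHenon a₀ a₁ c)^[n] (swapPairs ((coupledHenon a₀ a₁ c)^[n] p)) = swapPairs p := by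
  induction n with
  | zero => rfl
  | succ n ih =>
    rw [Function.iterate_succ_apply, Function.iterate_succ_apply',
      coupledHenon_swapPairs_coupledHenon, ih]

theorem IsNonWandering.swapPairs {a₀ a₁ c : ℝ} {p : ℝ × ℝ × ℝ × ℝ}
    (hp : IsNonWandering (coupledHenon a₀ a₁ c) p) :
    IsNonWandering (coupledHenon a₀ a₁ c) (swapPairs p) := by
  intro U hU hpU
  obtain ⟨n, hn, _, ⟨q, hq, rfl⟩, hq'⟩ := hp _ (hU.preimage continuous_swapPairs) hpU
  exact ⟨n, hn, _, ⟨_, hq', iterate_coupledHenon_swapPairs a₀ a₁ c n q⟩, hq⟩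

theorem abs_add_le_sqrt_two_mul_sqrt (x y : ℝ) : |x + y| ≤ √2 * √(x ^ 2 + y ^ 2) := by
  rw [← Real.sqrt_mul (by norm_num)]
  exact Real.abs_le_sqrt (by nlinarith [sq_nonneg (x - y)])

/-- Outside the disc of radius `√2 (1 + √(1 + A))`, `A` the mean of the parameters, the norm of
the current pair strictly increases as soon as it does not decrease. -/
theorem headNorm_lt_headNorm_coupledHenon {a₀ a₁ c : ℝ} {p : ℝ × ℝ × ℝ × ℝ}
    (hA : -1 ≤ (a₀ + a₁) / 2) (hle : tailNorm p ≤ headNorm p)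
    (hlt : √2 * (1 + √(1 + (a₀ + a₁) / 2)) < headNorm p) :
    headNorm p < headNorm (coupledHenon a₀ a₁ c p) := by
  have hnext := (neg_abs_le _).trans' (neg_le_neg
    (abs_add_le_sqrt_two_mul_sqrt (coupledHenon a₀ a₁ c p).1 (coupledHenon a₀ a₁ c p).2.1))
  have hprev := (neg_abs_le _).trans' (neg_le_neg
    (abs_add_le_sqrt_two_mul_sqrt p.2.2.1 p.2.2.2))
  change -(√2 * headNorm (coupledHenon a₀ a₁ c p)) ≤ _ at hnext
  change -(√2 * tailNorm p) ≤ _ at hprev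
  have hsq : headNorm p ^ 2 = p.1 ^ 2 + p.2.1 ^ 2 := Real.sq_sqrt (by positivity)
  have h2 : √2 ^ 2 = 2 := Real.sq_sqrt (by norm_num)
  have hs : √(1 + (a₀ + a₁) / 2) ^ 2 = 1 + (a₀ + a₁) / 2 := Real.sq_sqrt (by linarith)
  have hpos : 0 < √2 := by positivity
  have hgap : (√2 * √(1 + (a₀ + a₁) / 2)) ^ 2 < (headNorm p - √2) ^ 2 :=
    pow_lt_pow_left₀ (by linarith) (by positivity) two_ne_zero
  rw [mul_pow, h2, hs, sub_sq, h2] at hgap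
  have hmul := mul_le_mul_of_nonneg_left hle hpos.le
  refine lt_of_mul_lt_mul_left ?_ hpos.le
  simp only [coupledHenon] at hnext ⊢
  linarith

theorem headNorm_coupledHenon_le_headNorm_iterate {a₀ a₁ c : ℝ} {p : ℝ × ℝ × ℝ × ℝ}
    (hA : -1 ≤ (a₀ + a₁) / 2) (hlt : √2 * (1 + √(1 + (a₀ + a₁) / 2)) < headNorm p)
    (hle : headNorm p ≤ headNorm (coupledHenon a₀ a₁ c p)) (n : ℕ) :
    headNorm (coupledHenon a₀ a₁ c p) ≤ headNorm ((coupledHenon a₀ a₁ c)^[n + 1] p) := by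
  induction n generalizing p with
  | zero => rfl
  | succ n ih =>
    have hstep : headNorm (coupledHenon a₀ a₁ c p) <
        headNorm (coupledHenon a₀ a₁ c (coupledHenon a₀ a₁ c p)) :=
      headNorm_lt_headNorm_coupledHenon hA hle (hlt.trans_le hle)
    exact hstep.le.trans (ih (hlt.trans_le hle) hstep.le)

theorem IsNonWandering.headNorm_le {a₀ a₁ c : ℝ} {p : ℝ × ℝ × ℝ × ℝ}
    (hA : -1 ≤ (a₀ + a₁) / 2) (hp : IsNonWandering (coupledHenon a₀ a₁ c) p)
    (hle : tailNorm p ≤ headNorm p) :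
    headNorm p ≤ √2 * (1 + √(1 + (a₀ + a₁) / 2)) := by
  by_contra! hlt
  obtain ⟨m, hm, hm'⟩ := exists_between (headNorm_lt_headNorm_coupledHenon (c := c) hA hle hlt)
  have hnext := continuous_headNorm.comp (continuous_coupledHenon a₀ a₁ c)
  obtain ⟨n, hn, _, ⟨q, ⟨hq, hqm, hqm'⟩, rfl⟩, -, hreturn, -⟩ :=
    hp _ ((isOpen_lt continuous_const continuous_headNorm).inter
      ((isOpen_lt continuous_headNorm continuous_const).inter (isOpen_lt continuous_const hnext)))
      ⟨hlt, hm, hm'⟩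
  obtain ⟨k, rfl⟩ := Nat.exists_eq_add_of_le' hn
  exact lt_asymm hreturn (hqm'.trans_le
    (headNorm_coupledHenon_le_headNorm_iterate hA hq (hqm.trans hqm').le k))

theorem stmt_12 (a₀ a₁ c : ℝ) (hc : 0 < c)
    (A₀ : ℝ) (hA₀def : A₀ = (a₀ + a₁) / 2) (hA₀ : -1 ≤ A₀)
    (r : ℝ) (hr : r = 2 * Real.sqrt 2 * (1 + Real.sqrt (1 + A₀)))
    (p : ℝ × ℝ × ℝ × ℝ) (hp : IsNonWandering (coupledHenon a₀ a₁ c) p) :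
    |p.1| ≤ r ∧ |p.2.1| ≤ r ∧ |p.2.2.1| ≤ r ∧ |p.2.2.2| ≤ r := by
  subst hA₀def
  have hbound : max (headNorm p) (tailNorm p) ≤ √2 * (1 + √(1 + (a₀ + a₁) / 2)) := by
    rcases le_total (tailNorm p) (headNorm p) with h | h
    · rw [max_eq_left h]
      exact hp.headNorm_le hA₀ h
    · rw [max_eq_right h]
      exact hp.swapPairs.headNorm_le hA₀ h
  have hκ : √2 * (1 + √(1 + (a₀ + a₁) / 2)) ≤ r := by
    have : 0 ≤ √2 * (1 + √(1 + (a₀ + a₁) / 2)) := by positivity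
    linarith
  have hhead := ((le_max_left _ _).trans hbound).trans hκ
  have htail := ((le_max_right _ _).trans hbound).trans hκ
  exact ⟨(Real.abs_le_sqrt (le_add_of_nonneg_right (sq_nonneg _))).trans hhead,
    (Real.abs_le_sqrt (le_add_of_nonneg_left (sq_nonneg _))).trans hhead,
    (Real.abs_le_sqrt (le_add_of_nonneg_right (sq_nonneg _))).trans htail,
    (Real.abs_le_sqrt (le_add_of_nonneg_left (sq_nonneg _))).trans htail⟩
end

section
/- Let f : ℝ⁴ → ℝ⁴ be the coupled Hénon map with real parameters a₀, a₁ and c > 0, set A₀ = (a₀+a₁)/2, and assume A₀ ≥ −1. Then every non-wandering point (x,y,z,w) of f satisfies |(x+y)/2| ≤ R, |(x−y)/2| ≤ R, |(z+w)/2| ≤ R, and |(z−w)/2| ≤ R, where R = 1 + √(1+A₀); that is, Ω(f) ⊆ V_F = {(x,y,z,w) : |(x+y)/2|, |(x−y)/2|, |(z+w)/2|, |(z−w)/2| ≤ R}. -/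
/-- The involution exchanging the current and the previous state. -/
def swapState (p : ℝ × ℝ × ℝ × ℝ) : ℝ × ℝ × ℝ × ℝ := (p.2.2.1, p.2.2.2, p.1, p.2.1)

theorem continuous_swapState : Continuous swapState := by
  unfold swapState; fun_prop

/-- Reversibility: the swap conjugates the coupled Hénon map to its inverse. -/
theorem coupledHenon_swapState_coupledHenon (a₀ a₁ c : ℝ) (p : ℝ × ℝ × ℝ × ℝ) :
    coupledHenon a₀ a₁ c (swapState (coupledHenon a₀ a₁ c p)) = swapState p := by
  obtain ⟨x, y, z, w⟩ := p
  refine Prod.ext ?_ (Prod.ext ?_ rfl) <;> simp only [coupledHenon, swapState] <;> ring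

theorem iterate_swapState_iterate (a₀ a₁ c : ℝ) (n : ℕ) (p : ℝ × ℝ × ℝ × ℝ) :
    (coupledHenon a₀ a₁ c)^[n] (swapState ((coupledHenon a₀ a₁ c)^[n] p)) = swapState p := by
  induction n generalizing p with
  | zero => rfl
  | succ n ih =>
    rw [Function.iterate_succ_apply' _ n p, Function.iterate_succ_apply,
      coupledHenon_swapState_coupledHenon, ih]

theorem IsNonWandering.map {g : ℝ × ℝ × ℝ × ℝ → ℝ × ℝ × ℝ × ℝ} (hg : Continuous g)
    {p : ℝ × ℝ × ℝ × ℝ} (hp : IsNonWandering g p) : IsNonWandering g (g p) := by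
  intro U hU hpU
  obtain ⟨n, hn, _, ⟨u, hu, rfl⟩, hv⟩ := hp (g ⁻¹' U) (hU.preimage hg) hpU
  refine ⟨n, hn, g^[n] (g u), ⟨g u, hu, rfl⟩, ?_⟩
  rw [← Function.iterate_succ_apply, Function.iterate_succ_apply']
  exact hv

theorem IsNonWandering.swapState {a₀ a₁ c : ℝ} {p : ℝ × ℝ × ℝ × ℝ}
    (hp : IsNonWandering (coupledHenon a₀ a₁ c) p) :
    IsNonWandering (coupledHenon a₀ a₁ c) (swapState p) := by
  intro U hU hpU
  obtain ⟨n, hn, _, ⟨u, hu, rfl⟩, hv⟩ := hp _ (hU.preimage continuous_swapState) hpU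
  exact ⟨n, hn, _, ⟨_, hv, rfl⟩, by rw [iterate_swapState_iterate]; exact hu⟩

/-- A point is wandering if it lies in a forward invariant open set on which a continuous
function strictly decreases along orbits. -/
theorem not_isNonWandering_of_decreasing {g : ℝ × ℝ × ℝ × ℝ → ℝ × ℝ × ℝ × ℝ}
    (hg : Continuous g) {F : Set (ℝ × ℝ × ℝ × ℝ)} (hF : IsOpen F) {h : ℝ × ℝ × ℝ × ℝ → ℝ}
    (hh : Continuous h) (hinv : ∀ q ∈ F, g q ∈ F) (hdec : ∀ q ∈ F, h (g q) < h q)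
    {p : ℝ × ℝ × ℝ × ℝ} (hpF : p ∈ F) : ¬ IsNonWandering g p := by
  intro hp
  obtain ⟨m, hm₁, hm₂⟩ := exists_between (hdec p hpF)
  obtain ⟨n, hn, _, ⟨u, ⟨⟨huF, -⟩, hu⟩, rfl⟩, ⟨-, hv⟩, -⟩ :=
    hp (F ∩ {q | m < h q} ∩ {q | h (g q) < m})
      ((hF.inter (isOpen_lt continuous_const hh)).inter
        (isOpen_lt (hh.comp hg) continuous_const)) ⟨⟨hpF, hm₂⟩, hm₁⟩
  have key : ∀ k : ℕ, g^[k + 1] u ∈ F ∧ h (g^[k + 1] u) < m := by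
    intro k
    induction k with
    | zero => exact ⟨hinv u huF, hu⟩
    | succ k ih =>
      rw [Function.iterate_succ_apply']
      exact ⟨hinv _ ih.1, (hdec _ ih.1).trans ih.2⟩
  obtain ⟨k, rfl⟩ := Nat.exists_eq_add_of_le' hn
  exact lt_asymm hv (key k).2

section Bounds

variable {a₀ a₁ c R : ℝ} {p : ℝ × ℝ × ℝ × ℝ}

theorem coupledHenon_mean (a₀ a₁ c : ℝ) (q : ℝ × ℝ × ℝ × ℝ) :
    ((coupledHenon a₀ a₁ c q).1 + (coupledHenon a₀ a₁ c q).2.1) / 2 =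
      (a₀ + a₁) / 2 - ((q.1 + q.2.1) / 2) ^ 2 - ((q.1 - q.2.1) / 2) ^ 2
        - (q.2.2.1 + q.2.2.2) / 2 := by
  simp only [coupledHenon]; ring

/-- Points whose mean coordinate lies below `-R` and has just decreased are wandering. -/
theorem not_isNonWandering_of_mean_lt (hR1 : 1 ≤ R) (hR : R ^ 2 = 2 * R + (a₀ + a₁) / 2)
    (h₁ : (p.1 + p.2.1) / 2 < -R) (h₂ : (p.1 + p.2.1) / 2 < (p.2.2.1 + p.2.2.2) / 2) :
    ¬ IsNonWandering (coupledHenon a₀ a₁ c) p := by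
  have hdec : ∀ q ∈ {q : ℝ × ℝ × ℝ × ℝ | (q.1 + q.2.1) / 2 < -R} ∩
      {q | (q.1 + q.2.1) / 2 < (q.2.2.1 + q.2.2.2) / 2},
      ((coupledHenon a₀ a₁ c q).1 + (coupledHenon a₀ a₁ c q).2.1) / 2 < (q.1 + q.2.1) / 2 := by
    rintro q ⟨hq₁, hq₂⟩
    simp only [Set.mem_ofPred_eq] at hq₁ hq₂
    rw [coupledHenon_mean]
    nlinarith [sq_nonneg ((q.1 - q.2.1) / 2)]
  refine not_isNonWandering_of_decreasing (h := fun q => (q.1 + q.2.1) / 2)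
    (continuous_coupledHenon a₀ a₁ c)
    ((isOpen_lt (by fun_prop) (by fun_prop)).inter (isOpen_lt (by fun_prop) (by fun_prop)))
    (by fun_prop) (fun q hq => ⟨(hdec q hq).trans hq.1, ?_⟩) hdec ⟨h₁, h₂⟩
  simpa [coupledHenon] using hdec q hq

theorem IsNonWandering.neg_le_mean (hp : IsNonWandering (coupledHenon a₀ a₁ c) p)
    (hR1 : 1 ≤ R) (hR : R ^ 2 = 2 * R + (a₀ + a₁) / 2) : -R ≤ (p.1 + p.2.1) / 2 := by
  by_contra! h
  by_cases hb : (p.2.2.1 + p.2.2.2) / 2 < (p.1 + p.2.1) / 2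
  · exact not_isNonWandering_of_mean_lt hR1 hR (p := _root_.swapState p) (hb.trans h) hb
      hp.swapState
  · have hlt : ((coupledHenon a₀ a₁ c p).1 + (coupledHenon a₀ a₁ c p).2.1) / 2 <
        (p.1 + p.2.1) / 2 := by
      rw [coupledHenon_mean]
      nlinarith [sq_nonneg ((p.1 - p.2.1) / 2)]
    exact not_isNonWandering_of_mean_lt hR1 hR (hlt.trans h) hlt
      (hp.map (continuous_coupledHenon a₀ a₁ c))

theorem IsNonWandering.mean_sq_add_diff_sq_le (hp : IsNonWandering (coupledHenon a₀ a₁ c) p)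
    (hR1 : 1 ≤ R) (hR : R ^ 2 = 2 * R + (a₀ + a₁) / 2) :
    ((p.1 + p.2.1) / 2) ^ 2 + ((p.1 - p.2.1) / 2) ^ 2 ≤ R ^ 2 := by
  have h₁ := (hp.map (continuous_coupledHenon a₀ a₁ c)).neg_le_mean hR1 hR
  have h₂ : -R ≤ (p.2.2.1 + p.2.2.2) / 2 := hp.swapState.neg_le_mean hR1 hR
  rw [coupledHenon_mean] at h₁
  linarith

theorem IsNonWandering.abs_mean_le_and_abs_diff_le
    (hp : IsNonWandering (coupledHenon a₀ a₁ c) p)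
    (hR1 : 1 ≤ R) (hR : R ^ 2 = 2 * R + (a₀ + a₁) / 2) :
    |(p.1 + p.2.1) / 2| ≤ R ∧ |(p.1 - p.2.1) / 2| ≤ R := by
  have h := hp.mean_sq_add_diff_sq_le hR1 hR
  have hR0 : 0 ≤ R := zero_le_one.trans hR1
  exact ⟨abs_le_of_sq_le_sq (by nlinarith [sq_nonneg ((p.1 - p.2.1) / 2)]) hR0,
    abs_le_of_sq_le_sq (by nlinarith [sq_nonneg ((p.1 + p.2.1) / 2)]) hR0⟩

end Bounds

theorem stmt_13 (a₀ a₁ c : ℝ) (hc : 0 < c)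
    (A₀ : ℝ) (hA₀def : A₀ = (a₀ + a₁) / 2) (hA₀ : -1 ≤ A₀)
    (R : ℝ) (hR : R = 1 + Real.sqrt (1 + A₀))
    (p : ℝ × ℝ × ℝ × ℝ) (hp : IsNonWandering (coupledHenon a₀ a₁ c) p) :
    |(p.1 + p.2.1) / 2| ≤ R ∧ |(p.1 - p.2.1) / 2| ≤ R ∧
    |(p.2.2.1 + p.2.2.2) / 2| ≤ R ∧ |(p.2.2.1 - p.2.2.2) / 2| ≤ R := by
  have hR1 : 1 ≤ R := by
    rw [hR]; linarith [Real.sqrt_nonneg (1 + A₀)]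
  have hRsq : R ^ 2 = 2 * R + (a₀ + a₁) / 2 := by
    rw [← hA₀def, hR]
    linarith [Real.sq_sqrt (show 0 ≤ 1 + A₀ by linarith)]
  obtain ⟨h₁, h₂⟩ := hp.abs_mean_le_and_abs_diff_le hR1 hRsq
  exact ⟨h₁, h₂, hp.swapState.abs_mean_le_and_abs_diff_le hR1 hRsq⟩
end

section
/- Let c > 0 and λ > 1 be real numbers, and let x, y ∈ ℝ satisfy 2λ + 2 + c ≤ |x| and 2λ + 2 + c ≤ |y|. Let G be the 2×2 real matrix G = [[−2x + c, −c], [−c, −2y + c]]. Then for every vector w ∈ ℝ², (2λ + 2)·‖w‖ ≤ ‖G·w‖, where ‖·‖ is the Euclidean norm on ℝ². -/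
/-- A diagonal map whose entries are at least `m` in absolute value expands norms by `m`. -/
theorem EuclideanSpace.mul_norm_le_norm_diag {m p q : ℝ} (hm : 0 ≤ m) (hp : m ≤ |p|)
    (hq : m ≤ |q|) (w : EuclideanSpace ℝ (Fin 2)) :
    m * ‖w‖ ≤ ‖(!₂[p * w 0, q * w 1] : EuclideanSpace ℝ (Fin 2))‖ := by
  refine le_of_sq_le_sq ?_ (norm_nonneg _)
  rw [mul_pow, EuclideanSpace.real_norm_sq_eq, EuclideanSpace.real_norm_sq_eq]
  have hp2 : m ^ 2 ≤ p ^ 2 := by simpa using pow_le_pow_left₀ hm hp 2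
  have hq2 : m ^ 2 ≤ q ^ 2 := by simpa using pow_le_pow_left₀ hm hq 2
  simp only [Fin.sum_univ_two, Matrix.cons_val_zero, Matrix.cons_val_one]
  nlinarith [mul_le_mul_of_nonneg_right hp2 (sq_nonneg (w 0)),
    mul_le_mul_of_nonneg_right hq2 (sq_nonneg (w 1))]

/-- The coupling matrix `c • !![1, -1; -1, 1]` has operator norm at most `2 * c`. -/
theorem EuclideanSpace.norm_coupling_le {c : ℝ} (hc : 0 ≤ c) (w : EuclideanSpace ℝ (Fin 2)) :
    ‖(!₂[c * (w 0 - w 1), -(c * (w 0 - w 1))] : EuclideanSpace ℝ (Fin 2))‖ ≤ 2 * c * ‖w‖ := by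
  refine le_of_sq_le_sq ?_ (by positivity)
  rw [mul_pow, EuclideanSpace.real_norm_sq_eq, EuclideanSpace.real_norm_sq_eq]
  simp only [Fin.sum_univ_two, Matrix.cons_val_zero, Matrix.cons_val_one]
  nlinarith [sq_nonneg (c * (w 0 + w 1))]

theorem stmt_14 (c lam x y : ℝ) (hc : 0 < c) (hlam : 1 < lam)
    (hx : 2 * lam + 2 + c ≤ |x|) (hy : 2 * lam + 2 + c ≤ |y|)
    (G : Matrix (Fin 2) (Fin 2) ℝ) (hG : G = !![-2 * x + c, -c; -c, -2 * y + c])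
    (w : EuclideanSpace ℝ (Fin 2)) :
    (2 * lam + 2) * ‖w‖ ≤ ‖Matrix.toEuclideanLin G w‖ := by
  have hGw : Matrix.toEuclideanLin G w =
      !₂[c * (w 0 - w 1), -(c * (w 0 - w 1))] - !₂[2 * x * w 0, 2 * y * w 1] := by
    subst hG
    ext i
    fin_cases i <;>
      simp [Matrix.toLpLin_apply, dotProduct, Fin.sum_univ_two] <;> ring
  have hdiag := EuclideanSpace.mul_norm_le_norm_diag (m := 2 * (2 * lam + 2 + c))
    (p := 2 * x) (q := 2 * y) (by linarith)
    (by rw [abs_mul, abs_two]; linarith) (by rw [abs_mul, abs_two]; linarith) w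
  have hcoupling := EuclideanSpace.norm_coupling_le hc.le w
  rw [hGw, norm_sub_rev]
  refine le_trans ?_ (norm_sub_norm_le _ _)
  have : 0 ≤ (2 * lam + 2) * ‖w‖ := by positivity
  linarith
end

section
/- Let λ > 1 and let G be a 2×2 real matrix satisfying (2λ + 2)·‖v‖ ≤ ‖G·v‖ for all v ∈ ℝ². Define J : ℝ² × ℝ² → ℝ² × ℝ² by J(v⁺, v⁻) = (G·v⁺ − v⁻, v⁺). Then for every pair (v⁺, v⁻) with ‖v⁻‖ ≤ ‖v⁺‖, one has λ·‖(v⁺, v⁻)‖ ≤ ‖J(v⁺, v⁻)‖, where ‖(a,b)‖ = √(‖a‖² + ‖b‖²) and ‖·‖ is the Euclidean norm on ℝ². -/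
theorem stmt_15 (lam : ℝ) (hlam : 1 < lam)
    (G : Matrix (Fin 2) (Fin 2) ℝ)
    (hG : ∀ v : EuclideanSpace ℝ (Fin 2),
      (2 * lam + 2) * ‖v‖ ≤ ‖Matrix.toEuclideanLin G v‖)
    (vp vm : EuclideanSpace ℝ (Fin 2)) (hcone : ‖vm‖ ≤ ‖vp‖) :
    lam * Real.sqrt (‖vp‖ ^ 2 + ‖vm‖ ^ 2) ≤
      Real.sqrt (‖Matrix.toEuclideanLin G vp - vm‖ ^ 2 + ‖vp‖ ^ 2) := by
  have hexp : 2 * lam * ‖vp‖ ≤ ‖Matrix.toEuclideanLin G vp - vm‖ := by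
    linarith [hG vp, norm_sub_norm_le (Matrix.toEuclideanLin G vp) vm, norm_nonneg vp]
  have hexp_sq : (2 * lam * ‖vp‖) ^ 2 ≤ ‖Matrix.toEuclideanLin G vp - vm‖ ^ 2 := by
    gcongr
  have hcone_sq : lam ^ 2 * ‖vm‖ ^ 2 ≤ lam ^ 2 * ‖vp‖ ^ 2 := by
    gcongr
  apply Real.le_sqrt_of_sq_le
  rw [mul_pow, Real.sq_sqrt (by positivity)]
  nlinarith [sq_nonneg (lam * ‖vp‖), sq_nonneg ‖vp‖]
end

section
/- Let λ > 1 and let G be a 2×2 real matrix satisfying (2λ + 2)·‖v‖ ≤ ‖G·v‖ for all v ∈ ℝ². Define J' : ℝ² × ℝ² → ℝ² × ℝ² by J'(v⁺, v⁻) = (v⁻, −v⁺ + G·v⁻). Then for every pair (v⁺, v⁻) with ‖v⁺‖ < ‖v⁻‖, one has λ·‖(v⁺, v⁻)‖ ≤ ‖J'(v⁺, v⁻)‖, where ‖(a,b)‖ = √(‖a‖² + ‖b‖²) and ‖·‖ is the Euclidean norm on ℝ². -/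
theorem stmt_16 (lam : ℝ) (hlam : 1 < lam)
    (G : Matrix (Fin 2) (Fin 2) ℝ)
    (hG : ∀ v : EuclideanSpace ℝ (Fin 2),
      (2 * lam + 2) * ‖v‖ ≤ ‖Matrix.toEuclideanLin G v‖)
    (vp vm : EuclideanSpace ℝ (Fin 2)) (hcone : ‖vp‖ < ‖vm‖) :
    lam * Real.sqrt (‖vp‖ ^ 2 + ‖vm‖ ^ 2) ≤
      Real.sqrt (‖vm‖ ^ 2 + ‖-vp + Matrix.toEuclideanLin G vm‖ ^ 2) := by
  have hnorm : (2 * lam + 1) * ‖vm‖ ≤ ‖-vp + Matrix.toEuclideanLin G vm‖ := by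
    have htri : ‖Matrix.toEuclideanLin G vm‖ - ‖vp‖ ≤ ‖-vp + Matrix.toEuclideanLin G vm‖ := by
      rw [neg_add_eq_sub]
      exact norm_sub_norm_le _ _
    linarith [hG vm]
  have hsq : ((2 * lam + 1) * ‖vm‖) ^ 2 ≤ ‖-vp + Matrix.toEuclideanLin G vm‖ ^ 2 :=
    pow_le_pow_left₀ (by positivity) hnorm 2
  have hcone_sq : ‖vp‖ ^ 2 ≤ ‖vm‖ ^ 2 := pow_le_pow_left₀ (norm_nonneg _) hcone.le 2
  apply Real.le_sqrt_of_sq_le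
  rw [mul_pow, Real.sq_sqrt (by positivity)]
  calc lam ^ 2 * (‖vp‖ ^ 2 + ‖vm‖ ^ 2)
      ≤ lam ^ 2 * (‖vm‖ ^ 2 + ‖vm‖ ^ 2) := by gcongr
    _ ≤ ‖vm‖ ^ 2 + ((2 * lam + 1) * ‖vm‖) ^ 2 := by
      have hdiff : 0 ≤ (2 * lam ^ 2 + 4 * lam + 2) * ‖vm‖ ^ 2 := by positivity
      linarith
    _ ≤ ‖vm‖ ^ 2 + ‖-vp + Matrix.toEuclideanLin G vm‖ ^ 2 := by gcongr
end

section
/- Let c > 0 and λ > 1 be real numbers, and let X, Y ∈ ℝ satisfy 2λ + 2 + c ≤ |X| − |Y|. Let G̃ be the 2×2 real matrix G̃ = [[−2X, −2Y], [−2Y, −2X + 2c]]. Then for every vector w ∈ ℝ², (2λ + 2)·‖w‖ ≤ ‖G̃·w‖, where ‖·‖ is the Euclidean norm on ℝ². -/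
theorem stmt_17 (c lam X Y : ℝ) (hc : 0 < c) (hlam : 1 < lam)
    (hXY : 2 * lam + 2 + c ≤ |X| - |Y|)
    (G : Matrix (Fin 2) (Fin 2) ℝ)
    (hG : G = !![-2 * X, -2 * Y; -2 * Y, -2 * X + 2 * c])
    (w : EuclideanSpace ℝ (Fin 2)) :
    (2 * lam + 2) * ‖w‖ ≤ ‖Matrix.toEuclideanLin G w‖ := by
  have hswap : ‖!₂[w 1, w 0]‖ = ‖w‖ := by
    simp [EuclideanSpace.norm_eq, Fin.sum_univ_two, add_comm]
  have hproj : ‖!₂[0, w 1]‖ ≤ ‖w‖ := by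
    simp only [EuclideanSpace.norm_eq, Fin.sum_univ_two]
    apply Real.sqrt_le_sqrt
    simp [sq_nonneg]
  have hdecomp : (2 * X) • w =
      (2 * c) • !₂[0, w 1] - (2 * Y) • !₂[w 1, w 0] - Matrix.toEuclideanLin G w := by
    subst hG
    ext i
    fin_cases i <;>
      simp [Matrix.toLpLin_apply, dotProduct, Fin.sum_univ_two] <;> ring
  have htri : 2 * |X| * ‖w‖ ≤
      2 * c * ‖!₂[0, w 1]‖ + 2 * |Y| * ‖w‖ + ‖Matrix.toEuclideanLin G w‖ := by
    calc 2 * |X| * ‖w‖ = ‖(2 * X) • w‖ := by simp [norm_smul]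
      _ ≤ ‖(2 * c) • !₂[0, w 1]‖ + ‖(2 * Y) • !₂[w 1, w 0]‖
          + ‖Matrix.toEuclideanLin G w‖ := by
        rw [hdecomp]
        exact (norm_sub_le _ _).trans (by gcongr; exact norm_sub_le _ _)
      _ = _ := by
        rw [norm_smul, norm_smul, hswap]
        simp [abs_of_pos hc]
  have hw := norm_nonneg w
  have hcw := mul_le_mul_of_nonneg_left hproj hc.le
  have hgap := mul_le_mul_of_nonneg_right hXY hw
  have hlw : 0 ≤ (lam + 1) * ‖w‖ := by positivity
  linarith
end

section
/- Let f : ℝ⁴ → ℝ⁴ be the coupled Hénon map with real parameters a₀, a₁ and c > 0, set A₀ = (a₀+a₁)/2, assume A₀ ≥ −1, and let r = 2√2·(1 + √(1+A₀)) and V_f = {(x,y,z,w) : |x|,|y|,|z|,|w| ≤ r}. Assume that for each i ∈ {0,1}, c² + 4(a_i − (c+2)r) ≥ 0 and 4 + c < (−c + √(c² + 4(a_i − (c+2)r)))/2. Then every point (x,y,z,w) ∈ f(V_f) ∩ V_f satisfies |z| > 4 + c and |w| > 4 + c. -/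
/-- A lower bound on `t ^ 2 - c * t` bounds `|t|` below by the larger root of the
associated quadratic. -/
theorem quadratic_root_le_abs {c b t : ℝ} (hc : 0 ≤ c)
    (h : b ≤ t ^ 2 - c * t) : (-c + Real.sqrt (c ^ 2 + 4 * b)) / 2 ≤ |t| := by
  have hs : Real.sqrt (c ^ 2 + 4 * b) ≤ 2 * |t| + c := by
    apply Real.sqrt_le_iff.mpr
    refine ⟨by positivity, ?_⟩
    have := mul_le_mul_of_nonneg_left (neg_le_abs t) hc
    nlinarith [sq_abs t]
  linarith

theorem stmt_18 (a₀ a₁ c : ℝ) (hc : 0 < c)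
    (A₀ : ℝ) (hA₀def : A₀ = (a₀ + a₁) / 2) (hA₀ : -1 ≤ A₀)
    (r : ℝ) (hr : r = 2 * Real.sqrt 2 * (1 + Real.sqrt (1 + A₀)))
    (Vf : Set (ℝ × ℝ × ℝ × ℝ))
    (hVf : Vf = {p | |p.1| ≤ r ∧ |p.2.1| ≤ r ∧ |p.2.2.1| ≤ r ∧ |p.2.2.2| ≤ r})
    (hdisc₀ : 0 ≤ c ^ 2 + 4 * (a₀ - (c + 2) * r))
    (hdisc₁ : 0 ≤ c ^ 2 + 4 * (a₁ - (c + 2) * r))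
    (hhyp₀ : 4 + c < (-c + Real.sqrt (c ^ 2 + 4 * (a₀ - (c + 2) * r))) / 2)
    (hhyp₁ : 4 + c < (-c + Real.sqrt (c ^ 2 + 4 * (a₁ - (c + 2) * r))) / 2)
    (p : ℝ × ℝ × ℝ × ℝ) (hp : p ∈ coupledHenon a₀ a₁ c '' Vf ∩ Vf) :
    4 + c < |p.2.2.1| ∧ 4 + c < |p.2.2.2| := by
  obtain ⟨⟨⟨z, w, u, v⟩, hq, rfl⟩, hp⟩ := hp
  simp only [hVf, coupledHenon, Set.mem_ofPred_eq, abs_le] at hq hp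
  obtain ⟨hz, hw, hu, hv⟩ := hq
  obtain ⟨hx, hy, -, -⟩ := hp
  have hcz := mul_le_mul_of_nonneg_left hz.2 hc.le
  have hcw := mul_le_mul_of_nonneg_left hw.2 hc.le
  change 4 + c < |z| ∧ 4 + c < |w|
  exact ⟨hhyp₀.trans_le (quadratic_root_le_abs hc.le (by linarith)),
    hhyp₁.trans_le (quadratic_root_le_abs hc.le (by linarith))⟩
end

section
/- Let F : ℝ⁴ → ℝ⁴ be the transformed coupled Hénon map with real parameters A₀, A₁ and c > 0, assume A₀ ≥ −1, and set R = 1 + √(1+A₀), V_F = {(X,Y,Z,W) : |X|,|Y|,|Z|,|W| ≤ R}, W* = max(|2R − A₁|, |−2R − A₁|)/(2(c − R)), and Z* = √(A₀ − (W*)² − 2R). Assume A₁ ≤ R < c, R < A₀ − (W*)² − R, and W* ≤ R. Then every point (X,Y,Z,W) ∈ F(V_F) ∩ V_F satisfies |W| ≤ W* and |Z| ≥ Z*; in particular, if moreover Z* − W* ≥ 4 + c, then |Z| − |W| ≥ 4 + c for every such point. -/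
/-- A bound on `2 * y * (c - x)` with `x ≤ R < c` bounds `y`. -/
lemma abs_le_of_abs_mul_sub_le {x y c R M : ℝ} (hRc : R < c) (hx : x ≤ R)
    (h : |2 * y * (c - x)| ≤ M) : |y| ≤ M / (2 * (c - R)) := by
  rw [le_div_iff₀ (by linarith)]
  rw [abs_mul, abs_mul, abs_two, abs_of_pos (show 0 < c - x by linarith)] at h
  nlinarith [mul_nonneg (abs_nonneg y) (sub_nonneg.2 hx)]

theorem stmt_19 (A₀ A₁ c : ℝ) (hc : 0 < c) (hA₀ : -1 ≤ A₀)
    (R : ℝ) (hR : R = 1 + Real.sqrt (1 + A₀))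
    (VF : Set (ℝ × ℝ × ℝ × ℝ))
    (hVF : VF = {p | |p.1| ≤ R ∧ |p.2.1| ≤ R ∧ |p.2.2.1| ≤ R ∧ |p.2.2.2| ≤ R})
    (Wstar : ℝ) (hWstar : Wstar = max |2 * R - A₁| |-(2 * R) - A₁| / (2 * (c - R)))
    (Zstar : ℝ) (hZstar : Zstar = Real.sqrt (A₀ - Wstar ^ 2 - 2 * R))
    (h₁ : A₁ ≤ R) (h₂ : R < c) (h₃ : R < A₀ - Wstar ^ 2 - R) (h₄ : Wstar ≤ R) :
    (∀ p ∈ transformedHenon A₀ A₁ c '' VF ∩ VF,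
      |p.2.2.2| ≤ Wstar ∧ Zstar ≤ |p.2.2.1|) ∧
    (4 + c ≤ Zstar - Wstar →
      ∀ p ∈ transformedHenon A₀ A₁ c '' VF ∩ VF,
        4 + c ≤ |p.2.2.1| - |p.2.2.2|) := by
  have key : ∀ p ∈ transformedHenon A₀ A₁ c '' VF ∩ VF,
      |p.2.2.2| ≤ Wstar ∧ Zstar ≤ |p.2.2.1| := by
    subst hVF
    rintro _ ⟨⟨⟨x, y, z, w⟩, ⟨hx, -, hz, hw⟩, rfl⟩, hX, hY, -, -⟩
    simp only [transformedHenon] at hx hz hw hX hY ⊢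
    rw [abs_le] at hx hz hw hX hY
    have hW : |y| ≤ Wstar := by
      rw [hWstar]
      refine abs_le_of_abs_mul_sub_le h₂ hx.2 ((abs_le_max_abs_abs ?_ ?_).trans (max_comm _ _).le)
      · linarith
      · linarith
    refine ⟨hW, ?_⟩
    rw [hZstar]
    refine Real.sqrt_le_iff.2 ⟨abs_nonneg x, ?_⟩
    have hy : y ^ 2 ≤ Wstar ^ 2 := sq_le_sq' (abs_le.1 hW).1 (abs_le.1 hW).2
    rw [sq_abs]
    linarith
  refine ⟨key, fun h p hp => ?_⟩
  obtain ⟨hW, hZ⟩ := key p hp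
  linarith
end
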